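/- arXiv:2603.23658 — 2 statements merged into one kernel-verified Lean document; each statement's English description precedes it below -/
import Mathlib

section
/- (VarPro vs. Cauchy model reduction.) In the VarPro quadratic setting, assume additionally: g ≠ 0; ‖B‖ ≤ β with β > 0; 0 < α_low ≤ ‖A‖ ≤ α_high; λ ≥ λ_low > 0; gradient alignment ‖ḡ‖ ≥ κ_align·‖A‖·‖g‖ for some κ_align ∈ (0,1]; and curvature capture ⟨A w⋆, B(A w⋆)⟩ ≥ κ_curve·⟨g, Bg⟩ for some κ_curve > 0, where w⋆ = -(H + λI)⁻¹ḡ. Let Δ = ‖A‖·‖w⋆‖ and let h_C be the Cauchy point for radius Δ. Then the VarPro weak learner achieves sufficient model reduction relative to the Cauchy point: Q(0) - Q(A w⋆) ≥ c₂·(Q(0) - Q(h_C)), where c₂ = min{ κ_align·λ_low/(α_high²·β + λ_low), κ_curve·λ_low²/α_high⁴ } and c₂ ∈ (0, 1]. -/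
open scoped RealInnerProductSpace Classical

/-- The quadratic model `Q(h) = ⟨g, h⟩ + (1/2)⟨h, Bh⟩`. -/
noncomputable def quadModel {F : Type*} [NormedAddCommGroup F] [InnerProductSpace ℝ F]
    (B : F →L[ℝ] F) (g : F) (h : F) : ℝ :=
  ⟪g, h⟫ + (1 / 2) * ⟪h, B h⟫

/-- The Cauchy step size: `Δ/‖g‖` if `⟨g, Bg⟩ = 0`, else `min{Δ/‖g‖, ‖g‖²/⟨g, Bg⟩}`. -/
noncomputable def cauchyStepSize {F : Type*} [NormedAddCommGroup F] [InnerProductSpace ℝ F]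
    (B : F →L[ℝ] F) (g : F) (Δ : ℝ) : ℝ :=
  if ⟪g, B g⟫ = (0 : ℝ) then Δ / ‖g‖ else min (Δ / ‖g‖) (‖g‖ ^ 2 / ⟪g, B g⟫)

/-- The Cauchy point `h_C = -γ_C g`. -/
noncomputable def cauchyPoint {F : Type*} [NormedAddCommGroup F] [InnerProductSpace ℝ F]
    (B : F →L[ℝ] F) (g : F) (Δ : ℝ) : F :=
  -(cauchyStepSize B g Δ • g)

/-- The reduced Hessian `H = A† ∘ B ∘ A` on `ℝⁿ`. -/
noncomputable def redHess {n : ℕ} {F : Type*} [NormedAddCommGroup F] [InnerProductSpace ℝ F]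
    [CompleteSpace F] (A : EuclideanSpace ℝ (Fin n) →L[ℝ] F) (B : F →L[ℝ] F) :
    EuclideanSpace ℝ (Fin n) →L[ℝ] EuclideanSpace ℝ (Fin n) :=
  ContinuousLinearMap.adjoint A ∘L B ∘L A

/-- The VarPro optimal linear weights `w⋆ = -(H + λI)⁻¹ ḡ` with `ḡ = A†g`. -/
noncomputable def varproW {n : ℕ} {F : Type*} [NormedAddCommGroup F] [InnerProductSpace ℝ F]
    [CompleteSpace F] (A : EuclideanSpace ℝ (Fin n) →L[ℝ] F) (B : F →L[ℝ] F) (g : F)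
    (lam : ℝ) : EuclideanSpace ℝ (Fin n) :=
  -((Ring.inverse (redHess A B +
      lam • (1 : EuclideanSpace ℝ (Fin n) →L[ℝ] EuclideanSpace ℝ (Fin n))))
    (ContinuousLinearMap.adjoint A g))

section VarPro

variable {n : ℕ} {F : Type*} [NormedAddCommGroup F] [InnerProductSpace ℝ F]

theorem quadModel_zero (B : F →L[ℝ] F) (g : F) : quadModel B g 0 = 0 := by
  simp [quadModel]

theorem cauchyStepSize_le (B : F →L[ℝ] F) (g : F) (Δ : ℝ) :
    cauchyStepSize B g Δ ≤ Δ / ‖g‖ := by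
  unfold cauchyStepSize
  split_ifs
  · exact le_rfl
  · exact min_le_left _ _

/-- The model reduction of the Cauchy point is at most its first-order bound `Δ‖g‖`. -/
theorem neg_quadModel_cauchyPoint_le (B : F →L[ℝ] F) (hB : ∀ x : F, 0 ≤ ⟪x, B x⟫)
    {g : F} (hg : g ≠ 0) (Δ : ℝ) :
    -quadModel B g (cauchyPoint B g Δ) ≤ Δ * ‖g‖ := by
  have hg' : 0 < ‖g‖ := norm_pos_iff.mpr hg
  have hstep : cauchyStepSize B g Δ * ‖g‖ ≤ Δ := (le_div_iff₀ hg').mp (cauchyStepSize_le B g Δ)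
  have hinner : ⟪g, cauchyPoint B g Δ⟫ = -(cauchyStepSize B g Δ * ‖g‖ * ‖g‖) := by
    rw [cauchyPoint, inner_neg_right, real_inner_smul_right, real_inner_self_eq_norm_sq]
    ring
  have hpos := hB (cauchyPoint B g Δ)
  have hmul := mul_le_mul_of_nonneg_right hstep hg'.le
  rw [quadModel, hinner]
  linarith

variable [CompleteSpace F]

theorem inner_redHess (A : EuclideanSpace ℝ (Fin n) →L[ℝ] F) (B : F →L[ℝ] F)
    (w : EuclideanSpace ℝ (Fin n)) : ⟪w, redHess A B w⟫ = ⟪A w, B (A w)⟫ := by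
  simp [redHess, ContinuousLinearMap.adjoint_inner_right]

theorem norm_redHess_le (A : EuclideanSpace ℝ (Fin n) →L[ℝ] F) (B : F →L[ℝ] F) :
    ‖redHess A B‖ ≤ ‖A‖ ^ 2 * ‖B‖ := by
  calc ‖redHess A B‖ ≤ ‖ContinuousLinearMap.adjoint A‖ * (‖B‖ * ‖A‖) :=
        (ContinuousLinearMap.opNorm_comp_le _ _).trans
          (mul_le_mul_of_nonneg_left (ContinuousLinearMap.opNorm_comp_le _ _) (norm_nonneg _))
    _ = ‖A‖ ^ 2 * ‖B‖ := by
        rw [LinearIsometryEquiv.norm_map]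
        ring

theorem isUnit_redHess_add_smul_one (A : EuclideanSpace ℝ (Fin n) →L[ℝ] F) (B : F →L[ℝ] F)
    (hB : ∀ x : F, 0 ≤ ⟪x, B x⟫) {lam : ℝ} (hlam : 0 < lam) :
    IsUnit (redHess A B +
      lam • (1 : EuclideanSpace ℝ (Fin n) →L[ℝ] EuclideanSpace ℝ (Fin n))) := by
  set M := redHess A B + lam • (1 : EuclideanSpace ℝ (Fin n) →L[ℝ] EuclideanSpace ℝ (Fin n))
  have hinj : Function.Injective M := by
    rw [injective_iff_map_eq_zero]
    intro w hw
    have hzero : ⟪w, M w⟫ = 0 := by rw [hw, inner_zero_right]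
    have hexpand : ⟪w, M w⟫ = ⟪A w, B (A w)⟫ + lam * ‖w‖ ^ 2 := by
      rw [← inner_redHess, ← real_inner_self_eq_norm_sq, ← real_inner_smul_right,
        ← inner_add_right]
      rfl
    have hnonneg := hB (A w)
    have hsq : ‖w‖ ^ 2 = 0 := by
      have := mul_nonneg hlam.le (sq_nonneg ‖w‖)
      have hprod : lam * ‖w‖ ^ 2 = 0 := by linarith
      exact (mul_eq_zero.mp hprod).resolve_left hlam.ne'
    exact norm_eq_zero.mp (pow_eq_zero_iff two_ne_zero |>.mp hsq)
  exact ContinuousLinearMap.isUnit_iff_bijective.mpr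
    ⟨hinj, (LinearMap.injective_iff_surjective (f := M.toLinearMap)).mp hinj⟩

/-- The regularized normal equation `(H + λI) w⋆ = -ḡ`. -/
theorem redHess_varproW_add (A : EuclideanSpace ℝ (Fin n) →L[ℝ] F) (B : F →L[ℝ] F)
    (hB : ∀ x : F, 0 ≤ ⟪x, B x⟫) (g : F) {lam : ℝ} (hlam : 0 < lam) :
    redHess A B (varproW A B g lam) + lam • varproW A B g lam =
      -ContinuousLinearMap.adjoint A g := by
  have h := congrArg (fun T => T (ContinuousLinearMap.adjoint A g))
    (Ring.mul_inverse_cancel _ (isUnit_redHess_add_smul_one A B hB hlam))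
  rw [varproW, map_neg, smul_neg, ← neg_add]
  exact congrArg Neg.neg h

theorem neg_quadModel_varproW (A : EuclideanSpace ℝ (Fin n) →L[ℝ] F) (B : F →L[ℝ] F)
    (hB : ∀ x : F, 0 ≤ ⟪x, B x⟫) (g : F) {lam : ℝ} (hlam : 0 < lam) :
    -quadModel B g (A (varproW A B g lam)) =
      (1 / 2) * ⟪A (varproW A B g lam), B (A (varproW A B g lam))⟫ +
        lam * ‖varproW A B g lam‖ ^ 2 := by
  have hw := redHess_varproW_add A B hB g hlam
  set w := varproW A B g lam
  have hlin : ⟪g, A w⟫ = -(⟪A w, B (A w)⟫ + lam * ‖w‖ ^ 2) := by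
    rw [← ContinuousLinearMap.adjoint_inner_left, real_inner_comm,
      ← neg_neg (ContinuousLinearMap.adjoint A g), ← hw, inner_neg_right, inner_add_right,
      real_inner_smul_right, inner_redHess, real_inner_self_eq_norm_sq]
  rw [quadModel, hlin]
  ring

theorem norm_adjoint_le_mul_norm_varproW (A : EuclideanSpace ℝ (Fin n) →L[ℝ] F) (B : F →L[ℝ] F)
    (hB : ∀ x : F, 0 ≤ ⟪x, B x⟫) (g : F) {lam : ℝ} (hlam : 0 < lam) :
    ‖ContinuousLinearMap.adjoint A g‖ ≤ (‖A‖ ^ 2 * ‖B‖ + lam) * ‖varproW A B g lam‖ := by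
  rw [← norm_neg, ← redHess_varproW_add A B hB g hlam, add_mul]
  refine (norm_add_le _ _).trans (add_le_add ?_ ?_)
  · exact (redHess A B).le_of_opNorm_le (norm_redHess_le A B) _
  · rw [norm_smul, Real.norm_of_nonneg hlam.le]

end VarPro

/-- **VarPro vs. Cauchy model reduction.** Under gradient alignment, curvature
capture, featurizer bounds, and sufficient regularization, the VarPro weak learner `A w⋆`
achieves at least the fraction `c₂ ∈ (0,1]` of the Cauchy-point model reduction, where the
Cauchy point is taken for the radius `Δ = ‖A‖·‖w⋆‖`. -/
theorem stmt12 {n : ℕ} {F : Type*} [NormedAddCommGroup F] [InnerProductSpace ℝ F]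
    [CompleteSpace F]
    (A : EuclideanSpace ℝ (Fin n) →L[ℝ] F) (hA : A ≠ 0)
    (B : F →L[ℝ] F) (hBsa : ∀ x y : F, ⟪B x, y⟫ = ⟪x, B y⟫)
    (hBpsd : ∀ x : F, 0 ≤ ⟪x, B x⟫)
    (g : F) (hg : g ≠ 0)
    (β αlow αhigh lam lamLow κa κc : ℝ)
    (hβ : 0 < β) (hBnorm : ‖B‖ ≤ β)
    (hαlow : 0 < αlow) (hA1 : αlow ≤ ‖A‖) (hA2 : ‖A‖ ≤ αhigh)
    (hlamLow : 0 < lamLow) (hlam : lamLow ≤ lam)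
    (hκa0 : 0 < κa) (hκa1 : κa ≤ 1) (hκc : 0 < κc)
    (halign : κa * ‖A‖ * ‖g‖ ≤ ‖ContinuousLinearMap.adjoint A g‖)
    (hcurve : κc * ⟪g, B g⟫ ≤
      ⟪A (varproW A B g lam), B (A (varproW A B g lam))⟫) :
    0 < min (κa * lamLow / (αhigh ^ 2 * β + lamLow)) (κc * lamLow ^ 2 / αhigh ^ 4) ∧
    min (κa * lamLow / (αhigh ^ 2 * β + lamLow)) (κc * lamLow ^ 2 / αhigh ^ 4) ≤ 1 ∧
    min (κa * lamLow / (αhigh ^ 2 * β + lamLow)) (κc * lamLow ^ 2 / αhigh ^ 4) *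
        (quadModel B g 0 -
          quadModel B g (cauchyPoint B g (‖A‖ * ‖varproW A B g lam‖))) ≤
      quadModel B g 0 - quadModel B g (A (varproW A B g lam)) := by
  have hlam0 : 0 < lam := hlamLow.trans_le hlam
  have hαhigh : 0 < αhigh := hαlow.trans_le (hA1.trans hA2)
  have hden : 0 < αhigh ^ 2 * β + lamLow := by positivity
  have hc0 : 0 < min (κa * lamLow / (αhigh ^ 2 * β + lamLow))
      (κc * lamLow ^ 2 / αhigh ^ 4) := lt_min (by positivity) (by positivity)
  refine ⟨hc0, (min_le_left _ _).trans ?_, ?_⟩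
  · rw [div_le_one hden]
    have : κa * lamLow ≤ 1 * lamLow := mul_le_mul_of_nonneg_right hκa1 hlamLow.le
    have : 0 < αhigh ^ 2 * β := by positivity
    linarith
  · have hcauchy := neg_quadModel_cauchyPoint_le B hBpsd hg (‖A‖ * ‖varproW A B g lam‖)
    have hgrad := norm_adjoint_le_mul_norm_varproW A B hBpsd g hlam0
    have hcurv := hBpsd (A (varproW A B g lam))
    rw [quadModel_zero, zero_sub, zero_sub, neg_quadModel_varproW A B hBpsd g hlam0]
    set w := varproW A B g lam
    have hAB : ‖A‖ ^ 2 * ‖B‖ ≤ αhigh ^ 2 * β := by gcongr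
    have halign' : κa * ‖A‖ * ‖g‖ ≤ (αhigh ^ 2 * β + lam) * ‖w‖ :=
      (halign.trans hgrad).trans
        (mul_le_mul_of_nonneg_right (by linarith) (norm_nonneg _))
    have hreg : lamLow * (αhigh ^ 2 * β + lam) ≤ lam * (αhigh ^ 2 * β + lamLow) := by
      have : lamLow * (αhigh ^ 2 * β) ≤ lam * (αhigh ^ 2 * β) :=
        mul_le_mul_of_nonneg_right hlam (by positivity)
      linarith
    have hfirst : κa * lamLow / (αhigh ^ 2 * β + lamLow) * (‖A‖ * ‖w‖ * ‖g‖) ≤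
        lam * ‖w‖ ^ 2 := by
      rw [div_mul_eq_mul_div, div_le_iff₀ hden]
      calc κa * lamLow * (‖A‖ * ‖w‖ * ‖g‖) = lamLow * ‖w‖ * (κa * ‖A‖ * ‖g‖) := by ring
        _ ≤ lamLow * ‖w‖ * ((αhigh ^ 2 * β + lam) * ‖w‖) := by gcongr
        _ = lamLow * (αhigh ^ 2 * β + lam) * ‖w‖ ^ 2 := by ring
        _ ≤ lam * (αhigh ^ 2 * β + lamLow) * ‖w‖ ^ 2 := by gcongr
        _ = lam * ‖w‖ ^ 2 * (αhigh ^ 2 * β + lamLow) := by ring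
    have hbound := (mul_le_mul_of_nonneg_left hcauchy hc0.le).trans
      ((mul_le_mul_of_nonneg_right (min_le_left _ _) (by positivity)).trans hfirst)
    linarith
end

section
/- Let F be a real Hilbert space, f ∈ F, and L : F → ℝ Fréchet differentiable at f with gradient g = ∇L(f), and suppose L satisfies the quadratic upper bound L(f + h) ≤ L(f) + ⟨g, h⟩ + (β/2)‖h‖² for all h ∈ F, with β > 0. Let A : ℝⁿ → F be continuous linear with ‖A‖ ≤ α_high, let ḡ = A†g be nonzero, let H be a symmetric positive semidefinite n×n matrix with ‖H‖ ≤ β·α_high², let λ > 0, and set w⋆ = -(H + λI)⁻¹ḡ. If λ ≥ (β·α_high²/2)·(1 + ρ)/(1 - ρ) for some ρ ∈ [0, 1), then the actual reduction dominates ρ times the predicted reduction: L(f) - L(f + A w⋆) ≥ ρ · w⋆ᵀ((1/2)H + λI)w⋆. (The right-hand factor w⋆ᵀ((1/2)H + λI)w⋆ is the predicted reduction of the quadratic model, and is strictly positive.) -/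
open scoped RealInnerProductSpace

/-- A positive semidefinite operator on a finite-dimensional real inner product space becomes
invertible after adding a positive multiple of the identity. -/
lemma isUnit_add_smul_one_of_inner_nonneg {E : Type*} [NormedAddCommGroup E]
    [InnerProductSpace ℝ E] [FiniteDimensional ℝ E] {H : E →L[ℝ] E}
    (hH : ∀ x : E, 0 ≤ ⟪x, H x⟫) {c : ℝ} (hc : 0 < c) :
    IsUnit (H + c • (1 : E →L[ℝ] E)) := by
  have : CompleteSpace E := FiniteDimensional.complete ℝ E
  have hinj : Function.Injective (H + c • (1 : E →L[ℝ] E)) := by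
    rw [injective_iff_map_eq_zero]
    intro x hx
    have h : ⟪x, H x⟫ + c * ‖x‖ ^ 2 = 0 := by
      simpa [inner_add_right, real_inner_smul_right] using congrArg (fun y => ⟪x, y⟫) hx
    have hnorm : ‖x‖ ^ 2 = 0 := by nlinarith [hH x, sq_nonneg ‖x‖]
    simpa using hnorm
  rw [ContinuousLinearMap.isUnit_iff_bijective]
  exact ⟨hinj, (LinearMap.injective_iff_surjective
    (f := (H + c • (1 : E →L[ℝ] E)).toLinearMap)).mp hinj⟩

/-- Suppose `L` is Fréchet differentiable at `f` with gradient `g` and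
satisfies the quadratic upper bound `L(f+h) ≤ L(f) + ⟨g,h⟩ + (β/2)‖h‖²`. Let `A : ℝⁿ → F` be
continuous linear with `‖A‖ ≤ α_high`, `ḡ = A†g ≠ 0`, `H` symmetric positive semidefinite on
`ℝⁿ` with (spectral/operator) norm `‖H‖ ≤ β·α_high²`, `λ > 0`, and
`w⋆ = -(H + λI)⁻¹ḡ`.  If `λ ≥ (β·α_high²/2)·(1+ρ)/(1-ρ)` with `ρ ∈ [0,1)`, then the actual
reduction dominates `ρ` times the predicted reduction `w⋆ᵀ((1/2)H + λI)w⋆`, which is strictly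
positive. -/
theorem stmt14 {n : ℕ} {F : Type*} [NormedAddCommGroup F] [InnerProductSpace ℝ F]
    [CompleteSpace F]
    (f : F) (L : F → ℝ) (g : F) (hgrad : HasGradientAt L g f)
    (β αhigh lam ρ : ℝ) (hβ : 0 < β)
    (hquad : ∀ h : F, L (f + h) ≤ L f + ⟪g, h⟫ + (β / 2) * ‖h‖ ^ 2)
    (A : EuclideanSpace ℝ (Fin n) →L[ℝ] F) (hAnorm : ‖A‖ ≤ αhigh)
    (hgbar : ContinuousLinearMap.adjoint A g ≠ 0)
    (H : EuclideanSpace ℝ (Fin n) →L[ℝ] EuclideanSpace ℝ (Fin n))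
    (hHsa : ∀ x y : EuclideanSpace ℝ (Fin n), ⟪H x, y⟫ = ⟪x, H y⟫)
    (hHpsd : ∀ x : EuclideanSpace ℝ (Fin n), 0 ≤ ⟪x, H x⟫)
    (hHnorm : ‖H‖ ≤ β * αhigh ^ 2)
    (hlam : 0 < lam) (hρ0 : 0 ≤ ρ) (hρ1 : ρ < 1)
    (hlamlb : β * αhigh ^ 2 / 2 * ((1 + ρ) / (1 - ρ)) ≤ lam) :
    ρ * ⟪-((Ring.inverse (H + lam •
            (1 : EuclideanSpace ℝ (Fin n) →L[ℝ] EuclideanSpace ℝ (Fin n))))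
          (ContinuousLinearMap.adjoint A g)),
        (((1 : ℝ) / 2) • H + lam •
            (1 : EuclideanSpace ℝ (Fin n) →L[ℝ] EuclideanSpace ℝ (Fin n)))
          (-((Ring.inverse (H + lam •
              (1 : EuclideanSpace ℝ (Fin n) →L[ℝ] EuclideanSpace ℝ (Fin n))))
            (ContinuousLinearMap.adjoint A g)))⟫ ≤
      L f - L (f + A (-((Ring.inverse (H + lam •
          (1 : EuclideanSpace ℝ (Fin n) →L[ℝ] EuclideanSpace ℝ (Fin n))))
        (ContinuousLinearMap.adjoint A g)))) ∧
    0 < ⟪-((Ring.inverse (H + lam •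
            (1 : EuclideanSpace ℝ (Fin n) →L[ℝ] EuclideanSpace ℝ (Fin n))))
          (ContinuousLinearMap.adjoint A g)),
        (((1 : ℝ) / 2) • H + lam •
            (1 : EuclideanSpace ℝ (Fin n) →L[ℝ] EuclideanSpace ℝ (Fin n)))
          (-((Ring.inverse (H + lam •
              (1 : EuclideanSpace ℝ (Fin n) →L[ℝ] EuclideanSpace ℝ (Fin n))))
            (ContinuousLinearMap.adjoint A g)))⟫ := by
  set u := Ring.inverse (H + lam •
    (1 : EuclideanSpace ℝ (Fin n) →L[ℝ] EuclideanSpace ℝ (Fin n)))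
    (ContinuousLinearMap.adjoint A g) with hu
  have hsolve : H u + lam • u = ContinuousLinearMap.adjoint A g := by
    have h := congrArg (fun T => T (ContinuousLinearMap.adjoint A g))
      (Ring.mul_inverse_cancel _ (isUnit_add_smul_one_of_inner_nonneg hHpsd hlam))
    simpa [← hu] using h
  have hu0 : u ≠ 0 := by
    intro h
    rw [h] at hsolve
    exact hgbar (by simpa using hsolve.symm)
  have hnorm : 0 < ‖u‖ ^ 2 := by positivity
  have hpred : ⟪-u, (((1 : ℝ) / 2) • H + lam •
      (1 : EuclideanSpace ℝ (Fin n) →L[ℝ] EuclideanSpace ℝ (Fin n))) (-u)⟫ =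
      1 / 2 * ⟪u, H u⟫ + lam * ‖u‖ ^ 2 := by
    rw [map_neg, inner_neg_neg]
    simp [inner_add_right, real_inner_smul_right]
  have hlin : ⟪g, A (-u)⟫ = -(⟪u, H u⟫ + lam * ‖u‖ ^ 2) := by
    rw [← ContinuousLinearMap.adjoint_inner_left, ← hsolve, inner_neg_right, real_inner_comm]
    simp [inner_add_right, real_inner_smul_right]
  have hA : ‖A (-u)‖ ^ 2 ≤ αhigh ^ 2 * ‖u‖ ^ 2 := by
    rw [← mul_pow]
    exact pow_le_pow_left₀ (norm_nonneg _) (by simpa using A.le_of_opNorm_le hAnorm (-u)) 2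
  have hH := hHpsd u
  rw [hpred]
  refine ⟨?_, by positivity⟩
  have hlam' : β * αhigh ^ 2 / 2 ≤ (1 - ρ) * lam := by
    rw [← mul_div_assoc, div_le_iff₀ (by linarith)] at hlamlb
    have : 0 ≤ β * αhigh ^ 2 / 2 * ρ := by positivity
    linarith
  have hq := hquad (A (-u))
  rw [hlin] at hq
  have h₁ := mul_le_mul_of_nonneg_left hA (half_pos hβ).le
  have h₂ := mul_le_mul_of_nonneg_right hlam' hnorm.le
  have h₃ : 0 ≤ (1 - ρ / 2) * ⟪u, H u⟫ := mul_nonneg (by linarith) hH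
  linarith
end
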